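/- For every 2×2 unitary matrix U, there exist a real number γ and 2×2 unitary matrices A, B, C with A·B·C = I₂ such that ∧(U) = (R_γ ⊗ I₂) · (I₂ ⊗ A) · CNOT · (I₂ ⊗ B) · CNOT · (I₂ ⊗ C), where R_γ = diag(1, e^{iγ}) is the relative phase shift; that is, every controlled unitary decomposes into a relative phase on the control, single-qubit gates on the target, and two CNOT gates. -/

import Mathlib

open Matrix Kronecker

noncomputable section

abbrev M2 := Matrix (Fin 2) (Fin 2) ℂ
abbrev M4 := Matrix (Fin 2 × Fin 2) (Fin 2 × Fin 2) ℂ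

/-- computational basis ket `|b⟩` of `ℂ²`, as a 2×1 matrix -/
def ket (b : Fin 2) : Matrix (Fin 2) (Fin 1) ℂ := Matrix.of fun i _ => if i = b then 1 else 0

/-- computational basis bra `⟨b|` -/
def bra (b : Fin 2) : Matrix (Fin 1) (Fin 2) ℂ := Matrix.of fun _ j => if j = b then 1 else 0

/-- rank-one projector `|b⟩⟨b|` -/
def proj (b : Fin 2) : M2 := ket b * bra b

/-- Pauli X -/
def Xg : M2 := !![0, 1; 1, 0]

/-- CNOT with control on the first factor -/
def CNOT : M4 := proj 0 ⊗ₖ (1 : M2) + proj 1 ⊗ₖ Xg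

/-- the controlled gate `∧(U) = |0⟩⟨0|⊗I₂ + |1⟩⟨1|⊗U` -/
def CU (U : M2) : M4 := proj 0 ⊗ₖ (1 : M2) + proj 1 ⊗ₖ U

/-- the relative phase shift `R_γ = diag(1, e^{iγ})` -/
def R (γ : ℝ) : M2 := !![1, 0; 0, Complex.exp (Complex.I * γ)]

lemma proj_mul_self (b : Fin 2) : proj b * proj b = proj b := by
  ext i j
  fin_cases b <;> fin_cases i <;> fin_cases j <;> simp [proj, ket, bra, Matrix.mul_apply]

lemma proj_mul_proj_of_ne {b c : Fin 2} (h : b ≠ c) : proj b * proj c = 0 := by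
  ext i j
  fin_cases b <;> fin_cases c <;> fin_cases i <;> fin_cases j <;>
    simp_all [proj, ket, bra, Matrix.mul_apply]

lemma R_mul_proj_zero (γ : ℝ) : R γ * proj 0 = proj 0 := by
  ext i j
  fin_cases i <;> fin_cases j <;> simp [R, proj, ket, bra, Matrix.mul_apply]

lemma R_mul_proj_one (γ : ℝ) : R γ * proj 1 = Complex.exp (Complex.I * γ) • proj 1 := by
  ext i j
  fin_cases i <;> fin_cases j <;> simp [R, proj, ket, bra, Matrix.mul_apply]

/-- On the control value `0` the circuit applies `A * B * C`, on the control value `1` it applies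
`A * X * B * X * C` together with the phase. -/
lemma circuit_eq (γ : ℝ) (A B C : M2) :
    (R γ ⊗ₖ (1 : M2)) * ((1 : M2) ⊗ₖ A) * CNOT * ((1 : M2) ⊗ₖ B) * CNOT * ((1 : M2) ⊗ₖ C) =
      proj 0 ⊗ₖ (A * B * C) +
        proj 1 ⊗ₖ (Complex.exp (Complex.I * γ) • (A * Xg * B * Xg * C)) := by
  simp only [CNOT, mul_add, add_mul, ← mul_kronecker_mul, mul_one, one_mul, R_mul_proj_zero,
    R_mul_proj_one, smul_mul_assoc, proj_mul_self, proj_mul_proj_of_ne zero_ne_one,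
    proj_mul_proj_of_ne one_ne_zero, smul_zero, zero_kronecker, add_zero, zero_add,
    smul_kronecker, kronecker_smul]

/-- The diagonal matrix `diag(e^{ix}, e^{-ix})`. -/
def phaseDiag (x : ℝ) : M2 := !![Complex.exp (Complex.I * x), 0; 0, Complex.exp (-(Complex.I * x))]

/-- The rotation matrix of angle `x`. -/
def planeRotation (x : ℝ) : M2 :=
  !![(Real.cos x : ℂ), -(Real.sin x : ℂ); (Real.sin x : ℂ), (Real.cos x : ℂ)]

lemma phaseDiag_mul (x y : ℝ) : phaseDiag x * phaseDiag y = phaseDiag (x + y) := by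
  simp [phaseDiag, ← Complex.exp_add, mul_add, add_comm]

lemma planeRotation_mul (x y : ℝ) : planeRotation x * planeRotation y = planeRotation (x + y) := by
  ext i j
  fin_cases i <;> fin_cases j <;>
    simp [planeRotation, Matrix.mul_apply, Complex.cos_add, Complex.sin_add] <;> ring

lemma phaseDiag_zero : phaseDiag 0 = 1 := by
  simp [phaseDiag, Matrix.one_fin_two]

lemma planeRotation_zero : planeRotation 0 = 1 := by
  simp [planeRotation, Matrix.one_fin_two]

lemma phaseDiag_conjTranspose (x : ℝ) : (phaseDiag x)ᴴ = phaseDiag (-x) := by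
  ext i j
  fin_cases i <;> fin_cases j <;> simp [phaseDiag, ← Complex.exp_conj]

lemma planeRotation_conjTranspose (x : ℝ) : (planeRotation x)ᴴ = planeRotation (-x) := by
  ext i j
  fin_cases i <;> fin_cases j <;>
    simp [planeRotation, ← Complex.cos_conj, ← Complex.sin_conj]

lemma Xg_mul_phaseDiag_mul_Xg (x : ℝ) : Xg * phaseDiag x * Xg = phaseDiag (-x) := by
  simp [Xg, phaseDiag]

lemma Xg_mul_rotation_mul_Xg (x : ℝ) : Xg * planeRotation x * Xg = planeRotation (-x) := by
  simp [Xg, planeRotation]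

lemma Xg_mul_self : Xg * Xg = 1 := by
  simp [Xg, Matrix.one_fin_two]

lemma Complex.exists_eq_exp_of_norm_eq_one {z : ℂ} (hz : ‖z‖ = 1) :
    ∃ x : ℝ, z = Complex.exp (Complex.I * x) :=
  ⟨z.arg, by simpa [hz, mul_comm] using (Complex.norm_mul_exp_arg_mul_I z).symm⟩

/-- A special unitary matrix, given by its first column, is a product of two diagonal phases and a
rotation. -/
lemma exists_euler_angles {a b : ℂ} (h : ‖a‖ ^ 2 + ‖b‖ ^ 2 = 1) :
    ∃ p θ s : ℝ, !![a, -star b; b, star a] = phaseDiag p * planeRotation θ * phaseDiag s := by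
  have hcos : Real.cos (Real.arccos ‖a‖) = ‖a‖ :=
    Real.cos_arccos (by linarith [norm_nonneg a]) (by nlinarith [sq_nonneg ‖b‖, norm_nonneg a])
  have hsin : Real.sin (Real.arccos ‖a‖) = ‖b‖ := by
    rw [Real.sin_arccos, ← h, add_sub_cancel_left, Real.sqrt_sq (norm_nonneg b)]
  have polar (z : ℂ) : z = ‖z‖ * Complex.exp (Complex.I * z.arg) := by
    rw [mul_comm Complex.I, Complex.norm_mul_exp_arg_mul_I]
  have polar_star (z : ℂ) : star z = ‖z‖ * Complex.exp (-(Complex.I * z.arg)) := by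
    conv_lhs => rw [polar z]
    simp [← Complex.exp_conj]
  refine ⟨(a.arg - b.arg) / 2, Real.arccos ‖a‖, (a.arg + b.arg) / 2, ?_⟩
  have e1 : Complex.exp (Complex.I * a.arg) =
      Complex.exp (Complex.I * ((a.arg - b.arg) / 2 : ℝ)) *
        Complex.exp (Complex.I * ((a.arg + b.arg) / 2 : ℝ)) := by
    rw [← Complex.exp_add]; push_cast; ring_nf
  have e2 : Complex.exp (-(Complex.I * a.arg)) =
      Complex.exp (-(Complex.I * ((a.arg - b.arg) / 2 : ℝ))) *
        Complex.exp (-(Complex.I * ((a.arg + b.arg) / 2 : ℝ))) := by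
    rw [← Complex.exp_add]; push_cast; ring_nf
  have e3 : Complex.exp (Complex.I * b.arg) =
      Complex.exp (-(Complex.I * ((a.arg - b.arg) / 2 : ℝ))) *
        Complex.exp (Complex.I * ((a.arg + b.arg) / 2 : ℝ)) := by
    rw [← Complex.exp_add]; push_cast; ring_nf
  have e4 : Complex.exp (-(Complex.I * b.arg)) =
      Complex.exp (Complex.I * ((a.arg - b.arg) / 2 : ℝ)) *
        Complex.exp (-(Complex.I * ((a.arg + b.arg) / 2 : ℝ))) := by
    rw [← Complex.exp_add]; push_cast; ring_nf
  have ha := polar a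
  have hb := polar b
  have hsa := polar_star a
  have hsb := polar_star b
  rw [e1] at ha
  rw [e2] at hsa
  rw [e3] at hb
  rw [e4] at hsb
  rw [phaseDiag, phaseDiag, planeRotation, hcos, hsin]
  ext i j
  fin_cases i <;> fin_cases j <;>
    simp only [Fin.zero_eta, Fin.mk_one, Matrix.mul_apply, Fin.sum_univ_two, of_apply, cons_val',
      cons_val_zero, cons_val_one, cons_val_fin_one]
  · linear_combination ha
  · linear_combination -hsb
  · linear_combination hb
  · linear_combination hsa

/-- A unitary `2 × 2` matrix is a phase times a special unitary matrix. -/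
lemma exists_phase_smul_of_unitary {U : M2} (hU : Uᴴ * U = 1) :
    ∃ (γ : ℝ) (a b : ℂ), ‖a‖ ^ 2 + ‖b‖ ^ 2 = 1 ∧
      U = Complex.exp (Complex.I * γ) • !![a, -star b; b, star a] := by
  have hdet : ‖U.det‖ = 1 := by
    have h := congrArg Matrix.det hU
    rw [det_mul, det_conjTranspose, det_one] at h
    have h2 := congrArg norm h
    rw [norm_mul, norm_star, norm_one] at h2
    nlinarith [norm_nonneg U.det]
  obtain ⟨x, hx⟩ := Complex.exists_eq_exp_of_norm_eq_one hdet
  have hadj : U.adjugate = U.det • Uᴴ := by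
    calc U.adjugate = Uᴴ * U * U.adjugate := by rw [hU, one_mul]
      _ = U.det • Uᴴ := by rw [mul_assoc, mul_adjugate, mul_smul_comm, mul_one]
  have hcol : star (U 0 0) * U 0 0 + star (U 1 0) * U 1 0 = 1 := by
    simpa [Matrix.mul_apply] using congrFun (congrFun hU 0) 0
  have h11 : U 1 1 = U.det * star (U 0 0) := by
    simpa [adjugate_fin_two] using congrFun (congrFun hadj 0) 0
  have h01 : -U 0 1 = U.det * star (U 1 0) := by
    simpa [adjugate_fin_two] using congrFun (congrFun hadj 0) 1
  set e := Complex.exp (Complex.I * (x / 2 : ℝ)) with he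
  have hee : U.det = e * e := by
    rw [hx, he, ← Complex.exp_add]; push_cast; ring_nf
  have hne : ‖e‖ = 1 := by rw [he, mul_comm, Complex.norm_exp_ofReal_mul_I]
  have hse : star e * e = 1 := by simp [Complex.conj_mul', hne]
  refine ⟨x / 2, star e * U 0 0, star e * U 1 0, ?_, ?_⟩
  · simp only [norm_mul, norm_star, hne, one_mul]
    simp only [Complex.star_def, Complex.conj_mul'] at hcol
    exact_mod_cast hcol
  · rw [← he]
    rw [hee] at h11 h01
    ext i j
    fin_cases i <;> fin_cases j <;>
      simp only [Fin.zero_eta, Fin.mk_one, Matrix.smul_apply, of_apply, cons_val', cons_val_zero,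
        cons_val_one, cons_val_fin_one, smul_eq_mul, star_mul, star_star]
    · linear_combination -(U 0 0) * hse
    · linear_combination -h01
    · linear_combination -(U 1 0) * hse
    · linear_combination h11

/-- Every controlled unitary decomposes into a relative phase on the control, single-qubit
gates `A, B, C` with `A·B·C = I₂`, and two CNOT gates. -/
theorem controlled_unitary_phase_ABC (U : M2) (hU : Uᴴ * U = 1) :
    ∃ (γ : ℝ) (A B C : M2), Aᴴ * A = 1 ∧ Bᴴ * B = 1 ∧ Cᴴ * C = 1 ∧ A * B * C = 1 ∧
      CU U = (R γ ⊗ₖ (1 : M2)) * ((1 : M2) ⊗ₖ A) * CNOT * ((1 : M2) ⊗ₖ B) * CNOT *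
        ((1 : M2) ⊗ₖ C) := by
  obtain ⟨γ, a, b, hab, hW⟩ := exists_phase_smul_of_unitary hU
  obtain ⟨p, θ, s, hE⟩ := exists_euler_angles hab
  have rot_cancel (x : ℝ) (M : M2) : planeRotation (-x) * (planeRotation x * M) = M := by
    rw [← mul_assoc, planeRotation_mul, neg_add_cancel, planeRotation_zero, one_mul]
  have phase_cancel (x : ℝ) (M : M2) : phaseDiag (-x) * (phaseDiag x * M) = M := by
    rw [← mul_assoc, phaseDiag_mul, neg_add_cancel, phaseDiag_zero, one_mul]
  have rot_cancel' : planeRotation (θ / 2) * planeRotation (-(θ / 2)) = 1 := by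
    rw [planeRotation_mul, add_neg_cancel, planeRotation_zero]
  have hABC : phaseDiag p * planeRotation (θ / 2) *
      (planeRotation (-(θ / 2)) * phaseDiag (-((p + s) / 2))) * phaseDiag ((s - p) / 2) = 1 := by
    rw [mul_assoc (phaseDiag p), ← mul_assoc (planeRotation _), rot_cancel', one_mul, phaseDiag_mul,
      phaseDiag_mul, ← phaseDiag_zero]
    congr 1
    ring
  have hX : Xg * (planeRotation (-(θ / 2)) * phaseDiag (-((p + s) / 2))) * Xg =
      planeRotation (θ / 2) * phaseDiag ((p + s) / 2) := by
    calc _ = Xg * planeRotation (-(θ / 2)) * (Xg * Xg) * phaseDiag (-((p + s) / 2)) * Xg := by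
          rw [Xg_mul_self]; simp only [mul_assoc, one_mul]
      _ = (Xg * planeRotation (-(θ / 2)) * Xg) * (Xg * phaseDiag (-((p + s) / 2)) * Xg) := by
          simp only [mul_assoc]
      _ = _ := by rw [Xg_mul_rotation_mul_Xg, Xg_mul_phaseDiag_mul_Xg, neg_neg, neg_neg]
  have hAXBXC : phaseDiag p * planeRotation (θ / 2) * Xg *
      (planeRotation (-(θ / 2)) * phaseDiag (-((p + s) / 2))) * Xg * phaseDiag ((s - p) / 2) =
      phaseDiag p * planeRotation θ * phaseDiag s := by
    calc _ = phaseDiag p * planeRotation (θ / 2) *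
          (Xg * (planeRotation (-(θ / 2)) * phaseDiag (-((p + s) / 2))) * Xg) *
          phaseDiag ((s - p) / 2) := by simp only [mul_assoc]
      _ = phaseDiag p * (planeRotation (θ / 2) * planeRotation (θ / 2)) *
          (phaseDiag ((p + s) / 2) * phaseDiag ((s - p) / 2)) := by
          rw [hX]; simp only [mul_assoc]
      _ = _ := by
          rw [planeRotation_mul, phaseDiag_mul, add_halves]
          congr 2
          ring
  refine ⟨γ, phaseDiag p * planeRotation (θ / 2), planeRotation (-(θ / 2)) * phaseDiag (-((p + s) / 2)),
    phaseDiag ((s - p) / 2), ?_, ?_, ?_, hABC, ?_⟩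
  · rw [conjTranspose_mul, phaseDiag_conjTranspose, planeRotation_conjTranspose, mul_assoc,
      phase_cancel, planeRotation_mul, neg_add_cancel, planeRotation_zero]
  · rw [conjTranspose_mul, phaseDiag_conjTranspose, planeRotation_conjTranspose, mul_assoc,
      rot_cancel, phaseDiag_mul, neg_add_cancel, phaseDiag_zero]
  · rw [phaseDiag_conjTranspose, phaseDiag_mul, neg_add_cancel, phaseDiag_zero]
  · rw [circuit_eq, hABC, hAXBXC, ← hE, ← hW, CU]
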